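/- arXiv:math/0608243 — 2 statements merged into one kernel-verified Lean document; each statement's English description precedes it below -/
import Mathlib

section
/- Let g ≥ 2 be an integer. For Lebesgue-almost every x ∈ [0,1), lim_{n→∞} m_g^{(2)}(x,n)/n = log g / log 2; that is, the number of binary digits of x determined by its first n g-adic digits is asymptotically n·log g/log 2. -/
open MeasureTheory Filter Set

/-- The `g`-adic cylinder of rank `n` containing `x`. -/
noncomputable def radixCyl (g : ℕ) (n : ℕ) (x : ℝ) : Set ℝ :=
  Set.Ico ((⌊(g : ℝ) ^ n * x⌋ : ℝ) / (g : ℝ) ^ n) (((⌊(g : ℝ) ^ n * x⌋ : ℝ) + 1) / (g : ℝ) ^ n)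

/-- `mRadix g h x n` is the largest `m` with `A_n^{(g)}(x) ⊆ A_m^{(h)}(x)`: the number of
`h`-adic digits of `x` determined by its first `n` `g`-adic digits. -/
noncomputable def mRadix (g h : ℕ) (x : ℝ) (n : ℕ) : ℕ :=
  sSup {m : ℕ | radixCyl g n x ⊆ radixCyl h m x}


lemma radix_le (g : ℕ) (hg : 2 ≤ g) (x : ℝ) (n m : ℕ)
    (h : radixCyl g n x ⊆ radixCyl 2 m x) : (2 : ℝ) ^ m ≤ (g : ℝ) ^ n := by
  have hg0 : (0 : ℝ) < g := by exact_mod_cast (by omega : 0 < g)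
  have hN : (0 : ℝ) < (g : ℝ) ^ n := by positivity
  have hM : (0 : ℝ) < (2 : ℝ) ^ m := by positivity
  unfold radixCyl at h
  push_cast at h
  rw [Set.Ico_subset_Ico_iff (by gcongr; linarith)] at h
  obtain ⟨h1, h2⟩ := h
  rw [add_div] at h2
  rw [add_div] at h2
  have h3 : 1 / (g : ℝ) ^ n ≤ 1 / (2 : ℝ) ^ m := by linarith
  exact (one_div_le_one_div hN hM).1 h3

lemma radix_log_le (g : ℕ) (hg : 2 ≤ g) (x : ℝ) (n m : ℕ)
    (h : radixCyl g n x ⊆ radixCyl 2 m x) : (m : ℝ) ≤ Real.log g / Real.log 2 * n := by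
  have h1 := Real.log_le_log (by positivity) (radix_le g hg x n m h)
  rw [Real.log_pow, Real.log_pow] at h1
  have h2 : 0 < Real.log 2 := Real.log_pos (by norm_num)
  rw [div_mul_eq_mul_div, le_div_iff₀ h2]
  linarith

lemma radix_bdd (g : ℕ) (hg : 2 ≤ g) (x : ℝ) (n : ℕ) :
    BddAbove {m : ℕ | radixCyl g n x ⊆ radixCyl 2 m x} := by
  refine ⟨⌊Real.log g / Real.log 2 * n⌋₊, fun m hm => ?_⟩
  exact Nat.le_floor (radix_log_le g hg x n m hm)

lemma mRadix_le (g : ℕ) (hg : 2 ≤ g) (x : ℝ) (hx : x ∈ Set.Ico (0 : ℝ) 1) (n : ℕ) :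
    (mRadix g 2 x n : ℝ) ≤ Real.log g / Real.log 2 * n := by
  have hne : {m : ℕ | radixCyl g n x ⊆ radixCyl 2 m x}.Nonempty := by
    refine ⟨0, ?_⟩
    have hg0 : (0 : ℝ) < g := by exact_mod_cast (by omega : 0 < g)
    have hN : (0 : ℝ) < (g : ℝ) ^ n := by positivity
    have hf : ⌊x⌋ = 0 := Int.floor_eq_zero_iff.2 hx
    have h0 : 0 ≤ ⌊(g : ℝ) ^ n * x⌋ := Int.floor_nonneg.2 (mul_nonneg hN.le hx.1)
    have h1 : ⌊(g : ℝ) ^ n * x⌋ < (g ^ n : ℕ) := by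
      rw [Int.floor_lt]
      push_cast
      nlinarith [hx.2]
    have h2 : ((⌊(g : ℝ) ^ n * x⌋ : ℝ)) + 1 ≤ (g : ℝ) ^ n := by
      have : ⌊(g : ℝ) ^ n * x⌋ + 1 ≤ (g ^ n : ℕ) := h1
      exact_mod_cast this
    simp only [Set.mem_setOf_eq, radixCyl, pow_zero, one_mul, hf]
    apply Set.Ico_subset_Ico
    · have : (0 : ℝ) ≤ (⌊(g : ℝ) ^ n * x⌋ : ℝ) := by exact_mod_cast h0
      simp only [Int.cast_zero, zero_div]
      positivity
    · rw [div_le_iff₀ hN]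
      simpa using h2
  exact radix_log_le g hg x n _ (Nat.sSup_mem hne (radix_bdd g hg x n))

/-- Points close to a dyadic endpoint. -/
def badSet (N : ℝ) (M : ℕ) : Set ℝ :=
  ⋃ k ∈ Finset.range (M + 1), Set.Icc ((k : ℝ) / M - 1 / N) ((k : ℝ) / M + 1 / N)

lemma badSet_volume (N : ℝ) (hN : 0 < N) (M : ℕ) (hM : 1 ≤ M) :
    volume (badSet N M) ≤ ENNReal.ofReal (4 * (M / N)) := by
  refine (measure_biUnion_finset_le _ _).trans ?_
  have : ∀ k ∈ Finset.range (M + 1),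
      volume (Set.Icc ((k : ℝ) / M - 1 / N) ((k : ℝ) / M + 1 / N)) = ENNReal.ofReal (2 / N) := by
    intro k _
    rw [Real.volume_Icc]
    congr 1
    ring
  rw [Finset.sum_congr rfl this, ← ENNReal.ofReal_sum_of_nonneg (fun _ _ => by positivity)]
  apply ENNReal.ofReal_le_ofReal
  simp only [Finset.sum_const, Finset.card_range, nsmul_eq_mul]
  push_cast
  have : (1 : ℝ) ≤ M := by exact_mod_cast hM
  rw [← mul_div_assoc, ← mul_div_assoc]
  exact div_le_div_of_nonneg_right (by linarith) hN.le

lemma subset_of_notMem (g : ℕ) (hg : 2 ≤ g) (x : ℝ) (hx : x ∈ Set.Ico (0 : ℝ) 1) (n m : ℕ)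
    (h : x ∉ badSet ((g : ℝ) ^ n) (2 ^ m)) : radixCyl g n x ⊆ radixCyl 2 m x := by
  have hg0 : (0 : ℝ) < g := by exact_mod_cast (by omega : 0 < g)
  have hN : (0 : ℝ) < (g : ℝ) ^ n := by positivity
  have hM : (0 : ℝ) < (2 : ℝ) ^ m := by positivity
  simp only [badSet, Set.mem_iUnion, not_exists, Finset.mem_range] at h
  push_cast at h
  unfold radixCyl
  push_cast
  set N := (g : ℝ) ^ n
  have hb0 : 0 ≤ ⌊(2 : ℝ) ^ m * x⌋ := Int.floor_nonneg.2 (mul_nonneg hM.le hx.1)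
  have hb1 : ⌊(2 : ℝ) ^ m * x⌋ < (2 ^ m : ℕ) := by
    rw [Int.floor_lt]
    push_cast
    nlinarith [hx.2]
  have e1 : (⌊(2 : ℝ) ^ m * x⌋ : ℝ) / 2 ^ m ≤ x := by
    rw [div_le_iff₀ hM, mul_comm]; exact Int.floor_le _
  have e2 : x < ((⌊(2 : ℝ) ^ m * x⌋ : ℝ) + 1) / 2 ^ m := by
    rw [lt_div_iff₀ hM, mul_comm]; exact Int.lt_floor_add_one _
  have e3 : (⌊N * x⌋ : ℝ) / N ≤ x := by
    rw [div_le_iff₀ hN, mul_comm]; exact Int.floor_le _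
  have e4 : x < ((⌊N * x⌋ : ℝ) + 1) / N := by
    rw [lt_div_iff₀ hN, mul_comm]; exact Int.lt_floor_add_one _
  obtain ⟨b, hb⟩ := Int.eq_ofNat_of_zero_le hb0
  rw [hb] at hb1 e1 e2 ⊢
  have hb2 : b < 2 ^ m := by exact_mod_cast hb1
  simp only [Int.cast_natCast] at *
  have hN' : 0 < 1 / N := by positivity
  have e4' := e4
  rw [add_div] at e4'
  apply Set.Ico_subset_Ico
  · by_contra hc
    push Not at hc
    exact h b (by omega) ⟨by linarith, by linarith⟩
  · by_contra hc
    push Not at hc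
    rw [add_div (_ : ℝ) 1 N] at hc
    refine h (b + 1) (by omega) ⟨?_, ?_⟩ <;> push_cast <;> linarith

lemma ae_lower (g : ℕ) (hg : 2 ≤ g) (c : ℝ) (hc0 : 0 ≤ c) (hc : c < Real.log g / Real.log 2) :
    ∀ᵐ x ∂(volume : Measure ℝ), x ∈ Set.Ico (0 : ℝ) 1 →
      ∀ᶠ n : ℕ in atTop, ⌊c * n⌋₊ ≤ mRadix g 2 x n := by
  have hg0 : (0 : ℝ) < g := by exact_mod_cast (by omega : 0 < g)
  have h2 : 0 < Real.log 2 := Real.log_pos (by norm_num)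
  have hr : (2 : ℝ) ^ c / g < 1 := by
    rw [div_lt_one hg0, Real.rpow_def_of_pos (by norm_num), ← Real.lt_log_iff_exp_lt hg0]
    rw [lt_div_iff₀ h2] at hc
    linarith
  have hs : Summable (fun n : ℕ => 4 * ((2 : ℝ) ^ c / g) ^ n) :=
    (summable_geometric_of_lt_one (by positivity) hr).mul_left 4
  have hsum : ∑' n : ℕ, volume (badSet ((g : ℝ) ^ n) (2 ^ ⌊c * n⌋₊)) ≠ ⊤ := by
    refine ne_top_of_le_ne_top hs.tsum_ofReal_ne_top (ENNReal.tsum_le_tsum fun n => ?_)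
    refine (badSet_volume _ (by positivity) _ Nat.one_le_two_pow).trans ?_
    apply ENNReal.ofReal_le_ofReal
    rw [div_pow]
    gcongr
    push_cast
    rw [← Real.rpow_mul_natCast (by norm_num), ← Real.rpow_natCast]
    exact Real.rpow_le_rpow_of_exponent_le (by norm_num) (Nat.floor_le (by positivity))
  filter_upwards [ae_eventually_notMem hsum] with x hx hxI
  filter_upwards [hx] with n hn
  exact le_csSup (radix_bdd g hg x n) (subset_of_notMem g hg x hxI n _ hn)

theorem radix_vs_binary (g : ℕ) (hg : 2 ≤ g) :
    ∀ᵐ x ∂(volume : Measure ℝ), x ∈ Set.Ico (0 : ℝ) 1 →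
      Tendsto (fun n : ℕ => (mRadix g 2 x n : ℝ) / n) atTop
        (nhds (Real.log g / Real.log 2)) := by
  have hL : 0 < Real.log g / Real.log 2 :=
    div_pos (Real.log_pos (by exact_mod_cast (by omega : 1 < g))) (Real.log_pos (by norm_num))
  have key : ∀ᵐ x ∂(volume : Measure ℝ), ∀ q : ℚ, (0 : ℝ) ≤ q ∧ (q : ℝ) < Real.log g / Real.log 2 →
      x ∈ Set.Ico (0 : ℝ) 1 → ∀ᶠ n : ℕ in atTop, ⌊(q : ℝ) * n⌋₊ ≤ mRadix g 2 x n := by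
    rw [ae_all_iff]
    intro q
    by_cases hq : (0 : ℝ) ≤ q ∧ (q : ℝ) < Real.log g / Real.log 2
    · filter_upwards [ae_lower g hg q hq.1 hq.2] with x hx _ using hx
    · exact Eventually.of_forall fun x h => absurd h hq
  filter_upwards [key] with x hx hxI
  rw [tendsto_order]
  constructor
  · intro a ha
    obtain ⟨q, hq1, hq2⟩ := exists_rat_btwn (max_lt ha hL)
    have hqa : a < q := (le_max_left _ _).trans_lt hq1
    have hq0 : (0 : ℝ) ≤ q := (le_max_right _ _).trans hq1.le
    have ht : ∀ᶠ n : ℕ in atTop, 1 / (n : ℝ) < q - a :=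
      tendsto_one_div_atTop_nhds_zero_nat.eventually_lt_const (by linarith)
    filter_upwards [hx q ⟨hq0, hq2⟩ hxI, ht, eventually_gt_atTop 0] with n h1 h2 h3
    have hn : (0 : ℝ) < n := by exact_mod_cast h3
    have h4 : (q : ℝ) * n < mRadix g 2 x n + 1 :=
      (Nat.lt_floor_add_one _).trans_le (by gcongr)
    rw [lt_div_iff₀ hn]
    rw [div_lt_iff₀ hn] at h2
    linarith
  · intro a ha
    filter_upwards [eventually_gt_atTop 0] with n h3
    have hn : (0 : ℝ) < n := by exact_mod_cast h3
    refine lt_of_le_of_lt ?_ ha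
    rw [div_le_iff₀ hn]
    exact mRadix_le g hg x hxI n
end

section
/- Let g, h ≥ 2 be integers. For Lebesgue-almost every x ∈ [0,1), lim_{n→∞} m_g^{(h)}(x,n)/n = log g / log h; that is, the number of h-adic digits of x determined by its first n g-adic digits is asymptotically n·log g/log h. -/
open MeasureTheory Filter Set

lemma radix_ae (h : ℕ) (hh : 2 ≤ h) :
    ∀ᵐ x ∂(volume : Measure ℝ), ∀ᶠ m : ℕ in atTop, ∀ k ∈ Finset.range (h ^ m + 1),
      1 / ((m : ℝ) + 1) ^ 2 / (h : ℝ) ^ m < |x - (k : ℝ) / (h : ℝ) ^ m| := by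
  set E : ℕ → Set ℝ := fun m => ⋃ k ∈ Finset.range (h ^ m + 1),
    Metric.closedBall ((k : ℝ) / (h : ℝ) ^ m) (1 / ((m : ℝ) + 1) ^ 2 / (h : ℝ) ^ m) with hE
  have hpos : ∀ m : ℕ, (1 : ℝ) ≤ (h : ℝ) ^ m := fun m =>
    one_le_pow₀ (by exact_mod_cast (by omega : 1 ≤ h))
  have hbound : ∀ m, volume (E m) ≤ ENNReal.ofReal (4 * (1 / ((m : ℝ) + 1) ^ 2)) := by
    intro m
    refine (measure_biUnion_finset_le _ _).trans ?_
    simp only [Real.volume_closedBall]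
    rw [Finset.sum_const, Finset.card_range, nsmul_eq_mul, ← ENNReal.ofReal_natCast,
      ← ENNReal.ofReal_mul (by positivity)]
    apply ENNReal.ofReal_le_ofReal
    push_cast
    have h1 := hpos m
    have h0 : (0 : ℝ) < (h : ℝ) ^ m := by linarith
    have hd : 0 ≤ 1 / ((m : ℝ) + 1) ^ 2 := by positivity
    generalize 1 / ((m : ℝ) + 1) ^ 2 = d at hd
    rw [← mul_div_assoc, ← mul_div_assoc, div_le_iff₀ h0]
    nlinarith [mul_nonneg hd (sub_nonneg.2 h1)]
  have hsum : Summable (fun m : ℕ => 4 * (1 / ((m : ℝ) + 1) ^ 2)) := by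
    have h2 := (summable_nat_add_iff 1).2 (Real.summable_one_div_nat_pow.2 (by norm_num : 1 < 2))
    have h3 := h2.mul_left (4 : ℝ)
    simpa using h3
  have hfin : ∑' m, volume (E m) ≠ ⊤ :=
    ne_top_of_le_ne_top hsum.tsum_ofReal_ne_top (ENNReal.tsum_le_tsum hbound)
  filter_upwards [ae_eventually_notMem hfin] with x hx
  filter_upwards [hx] with m hm k hk
  by_contra hcon
  apply hm
  simp only [hE, mem_iUnion]
  exact ⟨k, hk, by rw [Metric.mem_closedBall, Real.dist_eq]; exact not_lt.1 hcon⟩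

lemma radix_bdd_s10 (g h : ℕ) (hg : 2 ≤ g) (x : ℝ) (n m : ℕ) (hh : 2 ≤ h)
    (hs : radixCyl g n x ⊆ radixCyl h m x) : (m : ℝ) * Real.log h ≤ n * Real.log g := by
  have hg0 : (0 : ℝ) < (g : ℝ) ^ n := pow_pos (by exact_mod_cast (by omega : 0 < g)) _
  have hh0 : (0 : ℝ) < (h : ℝ) ^ m := pow_pos (by exact_mod_cast (by omega : 0 < h)) _
  have hv := measure_mono (μ := (volume : Measure ℝ)) hs
  unfold radixCyl at hv
  rw [Real.volume_Ico, Real.volume_Ico, ← sub_div, ← sub_div, add_sub_cancel_left,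
    add_sub_cancel_left, ENNReal.ofReal_le_ofReal_iff (by positivity),
    one_div_le_one_div hg0 hh0] at hv
  have := Real.log_le_log hh0 hv
  rwa [Real.log_pow, Real.log_pow] at this

lemma radix_sub (g h : ℕ) (hg : 2 ≤ g) (hh : 2 ≤ h) (x : ℝ) (hx : x ∈ Set.Ico (0 : ℝ) 1)
    (n m : ℕ) (hm : ∀ k ∈ Finset.range (h ^ m + 1),
      1 / ((m : ℝ) + 1) ^ 2 / (h : ℝ) ^ m < |x - (k : ℝ) / (h : ℝ) ^ m|)
    (hle : (h : ℝ) ^ m * ((m : ℝ) + 1) ^ 2 ≤ (g : ℝ) ^ n) :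
    radixCyl g n x ⊆ radixCyl h m x := by
  have hg0 : (0 : ℝ) < (g : ℝ) ^ n := pow_pos (by exact_mod_cast (by omega : 0 < g)) _
  have hh0 : (0 : ℝ) < (h : ℝ) ^ m := pow_pos (by exact_mod_cast (by omega : 0 < h)) _
  have hd : 1 / (g : ℝ) ^ n ≤ 1 / ((m : ℝ) + 1) ^ 2 / (h : ℝ) ^ m := by
    rw [div_div, mul_comm]
    exact one_div_le_one_div_of_le (by positivity) hle
  have hy0 : 0 ≤ (h : ℝ) ^ m * x := mul_nonneg hh0.le hx.1
  have hy1 : (h : ℝ) ^ m * x < (h : ℝ) ^ m := by nlinarith [hx.2]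
  obtain ⟨k, hk⟩ : ∃ k : ℕ, ⌊(h : ℝ) ^ m * x⌋ = k := Int.eq_ofNat_of_zero_le (Int.floor_nonneg.2 hy0)
  have hf1 := Int.floor_le ((h : ℝ) ^ m * x)
  have hf2 := Int.lt_floor_add_one ((h : ℝ) ^ m * x)
  have hkl : k < h ^ m := by
    rw [hk] at hf1
    have : ((k : ℤ) : ℝ) < ((h ^ m : ℕ) : ℝ) := by push_cast; push_cast at hf1; linarith
    exact_mod_cast this
  have a1 := hm k (by simp; omega)
  have a2 := hm (k + 1) (by simp; omega)
  have e1 := Int.floor_le ((g : ℝ) ^ n * x)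
  have e2 := Int.lt_floor_add_one ((g : ℝ) ^ n * x)
  unfold radixCyl
  rw [hk] at hf1 hf2 ⊢
  push_cast at *
  have b1 : (k : ℝ) / (h : ℝ) ^ m ≤ x := by rw [div_le_iff₀ hh0]; linarith
  have b2 : x < ((k : ℝ) + 1) / (h : ℝ) ^ m := by rw [lt_div_iff₀ hh0]; linarith
  rw [abs_of_nonneg (by linarith)] at a1
  rw [abs_of_neg (by linarith)] at a2
  apply Set.Ico_subset_Ico
  · have : x ≤ ((⌊(g : ℝ) ^ n * x⌋ : ℝ) + 1) / (g : ℝ) ^ n := by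
      rw [le_div_iff₀ hg0]; linarith
    rw [add_div] at this
    linarith
  · have : (⌊(g : ℝ) ^ n * x⌋ : ℝ) / (g : ℝ) ^ n ≤ x := by
      rw [div_le_iff₀ hg0]; linarith
    rw [add_div (⌊(g : ℝ) ^ n * x⌋ : ℝ)]
    linarith

lemma radix_poly (ε : ℝ) (hε : 0 < ε) :
    ∀ᶠ m : ℕ in atTop, ((m : ℝ) + 1) ^ 2 ≤ Real.exp (ε * m) := by
  have hr : |Real.exp (-ε)| < 1 := by
    rw [abs_of_pos (Real.exp_pos _)]; exact Real.exp_lt_one_iff.2 (by linarith)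
  have h1 := (tendsto_add_atTop_iff_nat 1).2 (tendsto_pow_const_mul_const_pow_of_abs_lt_one 2 hr)
  filter_upwards [h1.eventually (gt_mem_nhds (Real.exp_pos (-ε)))] with m hm
  rw [← Real.exp_nat_mul] at hm
  push_cast at hm
  have e : Real.exp (((m : ℝ) + 1) * -ε) = Real.exp (-ε) * Real.exp (-(ε * m)) := by
    rw [← Real.exp_add]; congr 1; ring
  rw [e, Real.exp_neg (ε * m)] at hm
  have p := Real.exp_pos (-ε)
  have q := Real.exp_pos (ε * m)
  have : ((m : ℝ) + 1) ^ 2 * (Real.exp (ε * m))⁻¹ < 1 := by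
    by_contra hc
    nlinarith [not_lt.1 hc]
  rw [← div_eq_mul_inv, div_lt_one q] at this
  exact this.le

theorem radix_vs_radix (g h : ℕ) (hg : 2 ≤ g) (hh : 2 ≤ h) :
    ∀ᵐ x ∂(volume : Measure ℝ), x ∈ Set.Ico (0 : ℝ) 1 →
      Tendsto (fun n : ℕ => (mRadix g h x n : ℝ) / n) atTop
        (nhds (Real.log g / Real.log h)) := by
  have hlg : 0 < Real.log g := Real.log_pos (by exact_mod_cast (by omega : 1 < g))
  have hlh : 0 < Real.log h := Real.log_pos (by exact_mod_cast (by omega : 1 < h))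
  have hg0 : (0 : ℝ) < g := by exact_mod_cast (by omega : 0 < g)
  have hh0 : (0 : ℝ) < h := by exact_mod_cast (by omega : 0 < h)
  filter_upwards [radix_ae h hh] with x hae hx
  have hbdd : ∀ n, BddAbove {m : ℕ | radixCyl g n x ⊆ radixCyl h m x} := by
    intro n
    refine ⟨⌊(n : ℝ) * Real.log g / Real.log h⌋₊, fun m hm => Nat.le_floor ?_⟩
    rw [le_div_iff₀ hlh]
    exact radix_bdd_s10 g h hg x n m hh hm
  have hne : ∀ n, {m : ℕ | radixCyl g n x ⊆ radixCyl h m x}.Nonempty := by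
    intro n
    refine ⟨0, ?_⟩
    have hgn : (0 : ℝ) < (g : ℝ) ^ n := by positivity
    have hfx : ⌊x⌋ = 0 := Int.floor_eq_zero_iff.2 hx
    have hy1 : (g : ℝ) ^ n * x < (g : ℝ) ^ n := by nlinarith [hx.2]
    have hfl : ⌊(g : ℝ) ^ n * x⌋ + 1 ≤ ((g ^ n : ℕ) : ℤ) := by
      rw [Int.add_one_le_iff, Int.floor_lt]
      push_cast
      exact hy1
    have hfl' : (⌊(g : ℝ) ^ n * x⌋ : ℝ) + 1 ≤ (g : ℝ) ^ n := by exact_mod_cast hfl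
    have hf0 : (0 : ℝ) ≤ (⌊(g : ℝ) ^ n * x⌋ : ℝ) := by
      exact_mod_cast Int.floor_nonneg.2 (mul_nonneg hgn.le hx.1)
    simp only [mem_ofPred_eq, radixCyl, pow_zero, one_mul, hfx]
    apply Set.Ico_subset_Ico
    · simpa using div_nonneg hf0 hgn.le
    · rw [div_le_iff₀ hgn]; simpa using hfl'
  rw [tendsto_order]
  constructor
  · intro a ha
    obtain ⟨b, hb1, hb2⟩ := exists_between (max_lt ha (div_pos hlg hlh))
    have hb0 : 0 < b := (le_max_right _ _).trans_lt hb1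
    have hab : a < b := (le_max_left _ _).trans_lt hb1
    have hε : 0 < Real.log g / b - Real.log h := by
      rw [lt_div_iff₀ hlh] at hb2
      rw [sub_pos, lt_div_iff₀ hb0]; linarith
    have hnb : Tendsto (fun n : ℕ => b * (n : ℝ)) atTop atTop :=
      tendsto_natCast_atTop_atTop.const_mul_atTop hb0
    have hfl : Tendsto (fun n : ℕ => ⌊b * (n : ℝ)⌋₊) atTop atTop :=
      tendsto_nat_floor_atTop.comp hnb
    have hlarge : ∀ᶠ n : ℕ in atTop, 1 < (b - a) * (n : ℝ) :=
      (tendsto_natCast_atTop_atTop.const_mul_atTop (sub_pos.2 hab)).eventually_gt_atTop 1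
    filter_upwards [hfl.eventually hae, hfl.eventually (radix_poly _ hε), hlarge,
      eventually_gt_atTop 0] with n h1 h2 h3 h4
    have hn : (0 : ℝ) < n := by exact_mod_cast h4
    have hf1 : (⌊b * (n : ℝ)⌋₊ : ℝ) ≤ b * n := Nat.floor_le (by positivity)
    have hf2 := Nat.lt_floor_add_one (b * (n : ℝ))
    generalize ⌊b * (n : ℝ)⌋₊ = m at *
    have hle : (h : ℝ) ^ m * ((m : ℝ) + 1) ^ 2 ≤ (g : ℝ) ^ n := by
      calc (h : ℝ) ^ m * ((m : ℝ) + 1) ^ 2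
          ≤ (h : ℝ) ^ m * Real.exp ((Real.log g / b - Real.log h) * m) := by gcongr
        _ = Real.exp (m / b * Real.log g) := by
          rw [← Real.exp_log (pow_pos hh0 m), Real.log_pow, ← Real.exp_add]
          congr 1; ring
        _ ≤ Real.exp (n * Real.log g) := by
          apply Real.exp_le_exp.2
          apply mul_le_mul_of_nonneg_right _ hlg.le
          rw [div_le_iff₀ hb0]; linarith
        _ = (g : ℝ) ^ n := by
          rw [← Real.log_pow, Real.exp_log (pow_pos hg0 n)]
    have hmm : m ≤ mRadix g h x n := le_csSup (hbdd n) (radix_sub g h hg hh x hx n m h1 hle)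
    have hmm' : (m : ℝ) ≤ mRadix g h x n := by exact_mod_cast hmm
    rw [lt_div_iff₀ hn]
    linarith
  · intro a ha
    filter_upwards [eventually_gt_atTop 0] with n h4
    have hn : (0 : ℝ) < n := by exact_mod_cast h4
    refine lt_of_le_of_lt ?_ ha
    have := radix_bdd_s10 g h hg x n (mRadix g h x n) hh (Nat.sSup_mem (hne n) (hbdd n))
    rw [div_le_div_iff₀ hn hlh]
    linarith
end
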